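/- Let H be an infinite tree belonging to I_d. For every s ∈ H let P_s ⊆ ℕ^{<ω} be a set of proper extensions of s with P_s ∩ H = ∅, such that the sets (P_s)_{s∈H} are pairwise disjoint. Let P = ∪_{s∈H} P_s and R = H ∪ P. If I_wf↾P_s is isomorphic to an ideal in ℬ for every s ∈ H, then I_wf↾R is isomorphic to an ideal in ℬ. -/

import Mathlib

open Set

/-- The orthogonal of a family of sets: all sets having finite intersection
with every member of the family. -/
def orth {X : Type*} (I : Set (Set X)) : Set (Set X) :=
  {B | ∀ A ∈ I, (A ∩ B).Finite}

/-- `I` is an ideal on `X`: contains `∅`, closed under subsets and finite unions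
(the improper ideal `𝒫 X` is allowed). -/
def IsIdealOn {X : Type*} (I : Set (Set X)) : Prop :=
  ∅ ∈ I ∧ (∀ A ∈ I, ∀ B ⊆ A, B ∈ I) ∧ (∀ A ∈ I, ∀ B ∈ I, A ∪ B ∈ I)

/-- An ideal is Fréchet if it equals its double orthogonal. -/
def IsFrechet {X : Type*} (I : Set (Set X)) : Prop := orth (orth I) = I

/-- Isomorphism of ideals: a bijection of the underlying sets such that
`A ∈ I ↔ f '' A ∈ J`. -/
def IdealIso {X Y : Type*} (I : Set (Set X)) (J : Set (Set Y)) : Prop :=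
  ∃ f : X ≃ Y, ∀ A : Set X, A ∈ I ↔ f '' A ∈ J

/-- Isomorphic embedding of ideals: an injection of the underlying sets such that
`A ∈ I ↔ f '' A ∈ J`. -/
def IdealEmbeds {X Y : Type*} (I : Set (Set X)) (J : Set (Set Y)) : Prop :=
  ∃ f : X → Y, Function.Injective f ∧ ∀ A : Set X, A ∈ I ↔ f '' A ∈ J

/-- The restriction `I ↾ K` of an ideal on `X` to a subset `K ⊆ X`,
viewed as an ideal on the subtype `↥K`. -/
def restrictIdeal {X : Type*} (I : Set (Set X)) (K : Set X) : Set (Set ↥K) :=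
  {A | (Subtype.val '' A : Set X) ∈ I}

/-- `FIN`, the ideal of finite subsets of `ℕ`. -/
def finIdeal : Set (Set ℕ) := {A | A.Finite}

/-- Countable direct sum of ideals on `ℕ`, realized on `ℕ` via the pairing
bijection `ℕ × ℕ ≃ ℕ`: the `n`-th block is `{Nat.pair n m : m ∈ ℕ}`. -/
def directSumN (I : ℕ → Set (Set ℕ)) : Set (Set ℕ) :=
  {A | ∀ n, {m | Nat.pair n m ∈ A} ∈ I n}

/-- Finite direct sum `I 0 ⊕ ⋯ ⊕ I k` of ideals on `ℕ`, realized on `ℕ` using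
the partition of `ℕ` into residue classes mod `k + 1`. -/
def finSumN (k : ℕ) (I : ℕ → Set (Set ℕ)) : Set (Set ℕ) :=
  {A | ∀ i ≤ k, {m | m * (k + 1) + i ∈ A} ∈ I i}

/-- Binary direct sum of ideals on `ℕ`, realized on `ℕ` via evens and odds. -/
def sum2 (I J : Set (Set ℕ)) : Set (Set ℕ) :=
  {A | {m | 2 * m ∈ A} ∈ I ∧ {m | 2 * m + 1 ∈ A} ∈ J}

/-- All countable direct sums of members of `U`. -/
def sumsOf (U : Set (Set (Set ℕ))) : Set (Set (Set ℕ)) :=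
  {J | ∃ I : ℕ → Set (Set ℕ), (∀ n, I n ∈ U) ∧ J = directSumN I}

/-- `ℬ_α^{⊕⊥}`: countable direct sums of members of `U` together with their
orthogonals. -/
def sumsPerpOf (U : Set (Set (Set ℕ))) : Set (Set (Set ℕ)) :=
  sumsOf U ∪ {J | ∃ I ∈ sumsOf U, J = orth I}

/-- `ℬ_α`: finite direct sums of members of `ℬ_α^{⊕⊥}`. -/
def BstepOf (U : Set (Set (Set ℕ))) : Set (Set (Set ℕ)) :=
  {J | ∃ k, ∃ I : ℕ → Set (Set ℕ), (∀ i ≤ k, I i ∈ sumsPerpOf U) ∧ J = finSumN k I}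

/-- The hierarchy `ℬ_α`: `ℬ₀ = {𝒫(ℕ), FIN, 𝒫(ℕ) ⊕ FIN}` and, for `α > 0`,
`ℬ_α` consists of the finite direct sums of countable direct sums of members of
`⋃_{ξ<α} ℬ_ξ` and of orthogonals of such countable sums. -/
noncomputable def Bfam : Ordinal.{0} → Set (Set (Set ℕ)) :=
  WellFounded.fix wellFounded_lt fun α ih =>
    if α = 0 then {(Set.univ : Set (Set ℕ)), finIdeal, sum2 Set.univ finIdeal}
    else BstepOf {I | ∃ ξ, ∃ h : ξ < α, I ∈ ih ξ h}

/-- The first uncountable ordinal `ω₁`. -/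
noncomputable def omega1 : Ordinal.{0} := (Cardinal.aleph 1).ord

/-- An ideal (on any countable set) belongs to `ℬ = ⋃_{α<ω₁} ℬ_α`
(membership in `ℬ` is understood up to isomorphism). -/
def InB {X : Type*} (I : Set (Set X)) : Prop :=
  ∃ α, α < omega1 ∧ ∃ J ∈ Bfam α, IdealIso I J

/-- The ideals `P_α`: `P₀ = 𝒫(ℕ)`, `P_{α+1} = (P_α⊥)^ω`, and for limit `α`,
`P_α = ⊕ₙ P_{v α n}⊥` where `v α` is a fixed increasing sequence with supremum `α`. -/
noncomputable def Pfam (v : Ordinal.{0} → ℕ → Ordinal.{0}) : Ordinal.{0} → Set (Set ℕ) :=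
  fun α => @Ordinal.limitRecOn (fun _ => Set (Set ℕ)) α
    (Set.univ : Set (Set ℕ))
    (fun _ P => directSumN fun _ => orth P)
    (fun β _ ih => directSumN fun n =>
      if h : v β n < β then orth (ih (v β n) h) else ∅)

/-- The subset of the Cantor cube `2^X` corresponding to a family of subsets of `X`. -/
def idealSet {X : Type*} (I : Set (Set X)) : Set (X → Bool) := {f | {x | f x = true} ∈ I}

/-- An ideal is Borel if the corresponding subset of the Cantor cube `2^X` is Borel. -/
def IsBorelIdeal {X : Type*} (I : Set (Set X)) : Prop := MeasurableSet (idealSet I)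

/-- A subset of the Cantor cube is `F_σδ` if it is a countable intersection of
countable unions of closed sets. -/
def IsFsd {X : Type*} (S : Set (X → Bool)) : Prop :=
  ∃ C : ℕ → ℕ → Set (X → Bool), (∀ n m, IsClosed (C n m)) ∧ S = ⋂ n, ⋃ m, C n m

/-- The tree `⟨A⟩` generated by `A ⊆ ℕ^{<ω}`: all prefixes of members of `A`. -/
def genTree (A : Set (List ℕ)) : Set (List ℕ) := {t | ∃ a ∈ A, t <+: a}

/-- The ideal `I_wf` on `ℕ^{<ω}` of well founded sets: those `A` such that no
`α ∈ ℕ^ω` has all of its finite initial segments in `⟨A⟩`. -/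
def Iwf : Set (Set (List ℕ)) :=
  {A | ¬ ∃ α : ℕ → ℕ, ∀ n, (List.ofFn fun i : Fin n => α i) ∈ genTree A}

/-- The ideal `I_d = I_wf⊥` on `ℕ^{<ω}` of sets dominated by a branch. -/
def Idom : Set (Set (List ℕ)) :=
  {A | ∃ α : ℕ → ℕ, ∀ s ∈ A, ∀ i : Fin s.length, s.get i ≤ α i.1}

/-- `𝒩_t`, the set of extensions of `t` in `ℕ^{<ω}`. -/
def Nbhd (t : List ℕ) : Set (List ℕ) := {s | t <+: s}

/-- Direct sum of a sequence of ideals `I n` on sets `X n`, as an ideal on the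
disjoint union `Σ n, X n` (the partition into the fibers). -/
def sigmaSum {X : ℕ → Type*} (I : ∀ n, Set (Set (X n))) : Set (Set (Σ n, X n)) :=
  {A | ∀ n, {x | (⟨n, x⟩ : Σ n, X n) ∈ A} ∈ I n}

/-- Binary direct sum of ideals on `X` and `Y`, as an ideal on `X ⊕ Y`. -/
def sumIdeal2 {X Y : Type*} (I : Set (Set X)) (J : Set (Set Y)) : Set (Set (X ⊕ Y)) :=
  {A | (Sum.inl ⁻¹' A) ∈ I ∧ (Sum.inr ⁻¹' A) ∈ J}

/-- A tree on `ℕ`: a subset of `ℕ^{<ω}` downward closed under the prefix order. -/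
def IsTree (T : Set (List ℕ)) : Prop := ∀ s ∈ T, ∀ t, t <+: s → t ∈ T

/-- `A_a = {s ∈ A : a ≼ s}`. -/
def subAt (A : Set (List ℕ)) (a : List ℕ) : Set (List ℕ) := {s ∈ A | a <+: s}

/-- The derivative `A' = {a ∈ A : A_a ∉ I_d}`. -/
def derivD (A : Set (List ℕ)) : Set (List ℕ) := {a ∈ A | subAt A a ∉ Idom}

/-- The iterated derivative `A^{(α)}`. -/
noncomputable def derivIter (A : Set (List ℕ)) : Ordinal.{0} → Set (List ℕ) :=
  fun α => @Ordinal.limitRecOn (fun _ => Set (List ℕ)) α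
    A (fun _ S => derivD S) (fun β _ ih => ⋂ ξ, ⋂ h : ξ < β, ih ξ h)

/-- The rank of `A`: the least `α` with `A^{(α)} = A^{(α+1)}`. -/
noncomputable def rkD (A : Set (List ℕ)) : Ordinal.{0} :=
  sInf {α | derivIter A α = derivIter A (α + 1)}

/-- The ideal `WO(ℚ)` of well ordered (equivalently, well founded) subsets of `ℚ`. -/
def WOideal : Set (Set ℚ) := {A | A.IsWF}

/-- A subset of `ℚ` is scattered if `ℚ` does not order-embed into it. -/
def Scattered (A : Set ℚ) : Prop := ¬ ∃ f : ℚ → ℚ, (∀ q, f q ∈ A) ∧ StrictMono f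

/-- The dual filter of an ideal on `ℕ`. -/
def dualFilter (I : Set (Set ℕ)) : Set (Set ℕ) := {A | Aᶜ ∈ I}

/-- `U` is open in the topology `τ_F` on `ℕ^{<ω}` determined by the filter `F`. -/
def isTauOpen (F : Set (Set ℕ)) (U : Set (List ℕ)) : Prop :=
  ∀ s ∈ U, {n | s ++ [n] ∈ U} ∈ F


section Orthogonals

theorem subset_orth_orth {X : Type*} (I : Set (Set X)) : I ⊆ orth (orth I) := by
  intro A hA B hB
  rw [inter_comm]
  exact hB A hA

theorem isFrechet_of_subset {X : Type*} {I : Set (Set X)} (h : orth (orth I) ⊆ I) :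
    IsFrechet I :=
  h.antisymm (subset_orth_orth I)

theorem isFrechet_orth {X : Type*} (I : Set (Set X)) : IsFrechet (orth I) := by
  refine isFrechet_of_subset fun A hA B hB => ?_
  exact hA B (subset_orth_orth I hB)

theorem orth_univ : orth (Set.univ : Set (Set ℕ)) = finIdeal := by
  ext A
  refine ⟨fun h => ?_, fun h B _ => Set.Finite.inter_of_right h B⟩
  exact (h univ (mem_univ _)).subset (by simp)

theorem sum2_eq_finSumN (I J : Set (Set ℕ)) :
    sum2 I J = finSumN 1 fun i => if i = 0 then I else J := by
  ext A
  simp only [finSumN, sum2, mem_ofPred_eq, one_add_one_eq_two, mul_comm _ 2]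
  refine ⟨fun h i hi => ?_, fun h => ⟨h 0 zero_le_one, h 1 le_rfl⟩⟩
  interval_cases i
  exacts [h.1, h.2]

theorem eq_finSumN_zero (I : Set (Set ℕ)) : I = finSumN 0 fun _ => I := by
  ext A
  simp [finSumN]

theorem directSumN_univ : directSumN (fun _ => (Set.univ : Set (Set ℕ))) = Set.univ := by
  simp [directSumN]

/-- Orthogonals commute with finite direct sums of families containing `∅`. -/
theorem orth_finSumN (k : ℕ) (I : ℕ → Set (Set ℕ)) (h0 : ∀ i ≤ k, ∅ ∈ I i) :
    orth (finSumN k I) = finSumN k fun i => orth (I i) := by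
  have hinj : ∀ i, Function.Injective fun m => m * (k + 1) + i := fun i a b h =>
    Nat.eq_of_mul_eq_mul_right (Nat.succ_pos k) (Nat.add_right_cancel h)
  ext B
  constructor
  · intro hB i hi A hA
    have hmem : (fun m => m * (k + 1) + i) '' A ∈ finSumN k I := by
      intro j hj
      by_cases hij : j = i
      · subst hij
        have : {m | m * (k + 1) + j ∈ (fun m => m * (k + 1) + j) '' A} = A :=
          preimage_image_eq A (hinj j)
        rwa [this]
      · have : {m | m * (k + 1) + j ∈ (fun m => m * (k + 1) + i) '' A} = ∅ := by
          refine eq_empty_of_forall_notMem fun m => ?_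
          rintro ⟨a, -, ha⟩
          have := congrArg (· % (k + 1)) ha
          simp only [Nat.mul_add_mod_self_right, Nat.mod_eq_of_lt (Nat.lt_succ_of_le hi),
            Nat.mod_eq_of_lt (Nat.lt_succ_of_le hj)] at this
          exact hij this.symm
        rw [this]
        exact h0 j hj
    refine Set.Finite.of_finite_image ((hB _ hmem).subset ?_) (hinj i).injOn
    rintro _ ⟨m, ⟨hmA, hmB⟩, rfl⟩
    exact ⟨mem_image_of_mem _ hmA, hmB⟩
  · intro hB A hA
    have hfin : (⋃ i ∈ Iic k, (fun m => m * (k + 1) + i) ''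
        ({m | m * (k + 1) + i ∈ A} ∩ {m | m * (k + 1) + i ∈ B})).Finite :=
      (finite_Iic k).biUnion fun i hi => (hB i hi _ (hA i hi)).image _
    refine hfin.subset fun x hx => ?_
    have hdiv : x / (k + 1) * (k + 1) + x % (k + 1) = x := Nat.div_add_mod' x (k + 1)
    refine mem_biUnion (x := x % (k + 1)) (Nat.le_of_lt_succ (Nat.mod_lt x k.succ_pos))
      ⟨x / (k + 1), ?_, hdiv⟩
    simpa only [mem_inter_iff, mem_ofPred_eq, hdiv] using hx

theorem IsFrechet.finite_mem {X : Type*} {I : Set (Set X)} (h : IsFrechet I) {A : Set X}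
    (hA : A.Finite) : A ∈ I := by
  rw [← h]
  exact fun B _ => hA.inter_of_right B

theorem empty_mem_orth {X : Type*} (I : Set (Set X)) : ∅ ∈ orth I := by
  intro A _
  simp

theorem isFrechet_finSumN (k : ℕ) (I : ℕ → Set (Set ℕ)) (h : ∀ i ≤ k, IsFrechet (I i)) :
    IsFrechet (finSumN k I) := by
  rw [IsFrechet, orth_finSumN k I fun i hi => (h i hi).finite_mem finite_empty,
    orth_finSumN k _ fun i _ => empty_mem_orth _]
  ext A
  exact forall₂_congr fun i hi => by simp only [show orth (orth (I i)) = I i from h i hi]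

/-- The sections of the set which is `A` in the block `n` and is empty elsewhere. -/
theorem pair_image_section (n : ℕ) (A : Set ℕ) (j : ℕ) :
    {m | Nat.pair j m ∈ Nat.pair n '' A} = if j = n then A else ∅ := by
  ext m
  split_ifs with h
  · subst h
    simp [Nat.pair_eq_pair]
  · simp only [mem_ofPred_eq, mem_image, Nat.pair_eq_pair, mem_empty_iff_false, iff_false]
    rintro ⟨a, -, rfl, -⟩
    exact h rfl

/-- The orthogonal of a direct sum of families containing `∅` and the singletons. -/
theorem mem_orth_directSumN {I : ℕ → Set (Set ℕ)} (h0 : ∀ n, ∅ ∈ I n)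
    (h1 : ∀ n m, {m} ∈ I n) {A : Set ℕ} :
    A ∈ orth (directSumN I) ↔ (∀ n, {m | Nat.pair n m ∈ A} ∈ orth (I n)) ∧
      {n | {m | Nat.pair n m ∈ A}.Nonempty}.Finite := by
  have hinj : ∀ n, Function.Injective (Nat.pair n) := fun n a b h => (Nat.pair_eq_pair.1 h).2
  constructor
  · intro hA
    constructor
    · intro n B hB
      have hmem : Nat.pair n '' B ∈ directSumN I := by
        intro j
        rw [pair_image_section]
        split_ifs with h
        exacts [h ▸ hB, h0 j]
      refine Set.Finite.of_finite_image ((hA _ hmem).subset ?_) (hinj n).injOn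
      rintro _ ⟨m, ⟨hmB, hmA⟩, rfl⟩
      exact ⟨mem_image_of_mem _ hmB, hmA⟩
    · choose! c hc using fun n (hn : {m | Nat.pair n m ∈ A}.Nonempty) => hn
      have hmem : range (fun n => Nat.pair n (c n)) ∈ directSumN I := by
        intro n
        convert h1 n (c n) using 1
        ext m
        simp only [mem_ofPred_eq, mem_range, Nat.pair_eq_pair, mem_singleton_iff]
        constructor
        · rintro ⟨a, rfl, rfl⟩
          rfl
        · rintro rfl
          exact ⟨n, rfl, rfl⟩
      refine Set.Finite.of_finite_image (f := fun n => Nat.pair n (c n))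
        ((hA _ hmem).subset ?_) (fun a _ b _ h => (Nat.pair_eq_pair.1 h).1)
      rintro _ ⟨n, hn, rfl⟩
      exact ⟨mem_range_self n, hc n hn⟩
  · rintro ⟨hA, hfin⟩ B hB
    refine (hfin.biUnion fun n _ => (hA n _ (hB n)).image (Nat.pair n)).subset ?_
    rintro x ⟨hxB, hxA⟩
    have hx : Nat.pair x.unpair.1 x.unpair.2 = x := Nat.pair_unpair x
    refine mem_biUnion (x := x.unpair.1) ⟨x.unpair.2, ?_⟩ ⟨x.unpair.2, ⟨?_, ?_⟩, hx⟩ <;>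
      simpa only [mem_ofPred_eq, hx]

theorem isFrechet_directSumN {I : ℕ → Set (Set ℕ)} (h : ∀ n, IsFrechet (I n)) :
    IsFrechet (directSumN I) := by
  refine isFrechet_of_subset fun A hA n => ?_
  rw [← h n]
  intro B hB
  have hmem : Nat.pair n '' B ∈ orth (directSumN I) := by
    refine (mem_orth_directSumN (fun n => (h n).finite_mem finite_empty)
      fun n m => (h n).finite_mem (finite_singleton m)).2 ⟨fun j => ?_, ?_⟩
    · rw [pair_image_section]
      split_ifs with hj
      exacts [hj ▸ hB, empty_mem_orth _]
    · refine (finite_singleton n).subset fun j hj => ?_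
      by_contra hjn
      simp only [mem_ofPred_eq, pair_image_section, if_neg (show ¬ j = n from hjn),
        Set.not_nonempty_empty] at hj
  refine Set.Finite.of_finite_image ((hA _ hmem).subset ?_)
    (f := Nat.pair n) (fun a _ b _ h => (Nat.pair_eq_pair.1 h).2)
  rintro _ ⟨m, ⟨hmB, hmA⟩, rfl⟩
  exact ⟨mem_image_of_mem _ hmB, hmA⟩

end Orthogonals

section Hierarchy

theorem Bfam_zero :
    Bfam 0 = {(Set.univ : Set (Set ℕ)), finIdeal, sum2 Set.univ finIdeal} := by
  rw [Bfam, WellFounded.fix_eq, if_pos rfl]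

theorem Bfam_of_ne_zero {α : Ordinal.{0}} (h : α ≠ 0) :
    Bfam α = BstepOf {I | ∃ ξ, ∃ _ : ξ < α, I ∈ Bfam ξ} := by
  rw [Bfam, WellFounded.fix_eq, if_neg h]

theorem univ_mem_sumsPerpOf {U : Set (Set (Set ℕ))} (h : Set.univ ∈ U) :
    Set.univ ∈ sumsPerpOf U :=
  Or.inl ⟨fun _ => Set.univ, fun _ => h, directSumN_univ.symm⟩

theorem finIdeal_mem_sumsPerpOf {U : Set (Set (Set ℕ))} (h : Set.univ ∈ U) :
    finIdeal ∈ sumsPerpOf U :=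
  Or.inr ⟨Set.univ, ⟨fun _ => Set.univ, fun _ => h, directSumN_univ.symm⟩, orth_univ.symm⟩

theorem isFrechet_univ {X : Type*} : IsFrechet (Set.univ : Set (Set X)) :=
  isFrechet_of_subset (subset_univ _)

theorem isFrechet_finIdeal : IsFrechet finIdeal :=
  orth_univ ▸ isFrechet_orth _

theorem isFrechet_of_mem_Bfam {α : Ordinal.{0}} {J : Set (Set ℕ)} (hJ : J ∈ Bfam α) :
    IsFrechet J := by
  induction α using WellFoundedLT.induction generalizing J with
  | ind α ih =>
  by_cases hα : α = 0
  · subst hα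
    rw [Bfam_zero] at hJ
    rcases hJ with rfl | rfl | rfl
    · exact isFrechet_univ
    · exact isFrechet_finIdeal
    · rw [sum2_eq_finSumN]
      refine isFrechet_finSumN 1 _ fun i _ => ?_
      split_ifs
      exacts [isFrechet_univ, isFrechet_finIdeal]
  · rw [Bfam_of_ne_zero hα] at hJ
    obtain ⟨k, I, hI, rfl⟩ := hJ
    refine isFrechet_finSumN k I fun i hi => ?_
    rcases hI i hi with ⟨L, hL, h⟩ | ⟨L, -, h⟩ <;> rw [h]
    · exact isFrechet_directSumN fun n =>
        let ⟨ξ, hξ, hmem⟩ := hL n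
        ih ξ hξ hmem
    · exact isFrechet_orth L

theorem orth_mem_sumsPerpOf {U : Set (Set (Set ℕ))} (hU : ∀ I ∈ U, IsFrechet I)
    {J : Set (Set ℕ)} (hJ : J ∈ sumsPerpOf U) : orth J ∈ sumsPerpOf U := by
  rcases hJ with hJ | ⟨L, ⟨I, hI, rfl⟩, rfl⟩
  · exact Or.inr ⟨J, hJ, rfl⟩
  · refine Or.inl ⟨I, hI, ?_⟩
    exact isFrechet_directSumN fun n => hU _ (hI n)

theorem orth_mem_Bfam {α : Ordinal.{0}} (hα : α ≠ 0) {J : Set (Set ℕ)} (hJ : J ∈ Bfam α) :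
    orth J ∈ Bfam α := by
  have hU : ∀ I ∈ {I | ∃ ξ, ∃ _ : ξ < α, I ∈ Bfam ξ}, IsFrechet I :=
    fun I ⟨_, _, hI⟩ => isFrechet_of_mem_Bfam hI
  rw [Bfam_of_ne_zero hα] at hJ ⊢
  obtain ⟨k, I, hI, rfl⟩ := hJ
  refine ⟨k, fun i => orth (I i), fun i hi => orth_mem_sumsPerpOf hU (hI i hi),
    orth_finSumN k I fun i hi => ?_⟩
  rcases hI i hi with ⟨L, hL, h⟩ | ⟨L, -, h⟩ <;> rw [h]
  · exact fun n => (hU _ (hL n)).finite_mem finite_empty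
  · exact empty_mem_orth L

theorem Bfam_zero_subset_Bfam_one : Bfam 0 ⊆ Bfam 1 := by
  have huniv : Set.univ ∈ {I | ∃ ξ, ∃ _ : ξ < (1 : Ordinal.{0}), I ∈ Bfam ξ} :=
    ⟨0, zero_lt_one, by simp [Bfam_zero]⟩
  intro J hJ
  rw [Bfam_of_ne_zero one_ne_zero]
  rw [Bfam_zero] at hJ
  rcases hJ with rfl | rfl | rfl
  · exact ⟨0, fun _ => Set.univ, fun _ _ => univ_mem_sumsPerpOf huniv, eq_finSumN_zero _⟩
  · exact ⟨0, fun _ => finIdeal, fun _ _ => finIdeal_mem_sumsPerpOf huniv,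
      eq_finSumN_zero _⟩
  · refine ⟨1, fun i => if i = 0 then Set.univ else finIdeal, fun i _ => ?_,
      sum2_eq_finSumN _ _⟩
    dsimp only
    split_ifs
    exacts [univ_mem_sumsPerpOf huniv, finIdeal_mem_sumsPerpOf huniv]

theorem omega1_eq : omega1 = Ordinal.omega 1 := Cardinal.ord_aleph 1

/-- The union of the levels below `ω₁` is closed under orthogonals. -/
theorem exists_orth_mem_Bfam {α : Ordinal.{0}} (hα : α < omega1) {J : Set (Set ℕ)}
    (hJ : J ∈ Bfam α) : ∃ β < omega1, orth J ∈ Bfam β := by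
  by_cases h : α = 0
  · subst h
    exact ⟨1, omega1_eq ▸ Ordinal.one_lt_omega0.trans (Ordinal.omega0_lt_omega_one),
      orth_mem_Bfam one_ne_zero (Bfam_zero_subset_Bfam_one hJ)⟩
  · exact ⟨α, hα, orth_mem_Bfam h hJ⟩

/-- `FIN ⊕ (⊕ₙ J n)⊥` belongs to `ℬ` as soon as each `J n` does. -/
theorem exists_sum2_finIdeal_orth_mem_Bfam {α : ℕ → Ordinal.{0}} (hα : ∀ n, α n < omega1)
    {J : ℕ → Set (Set ℕ)} (hJ : ∀ n, J n ∈ Bfam (α n)) :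
    ∃ β < omega1, sum2 finIdeal (orth (directSumN J)) ∈ Bfam β := by
  refine ⟨Order.succ (⨆ n, α n), ?_, ?_⟩
  · rw [omega1_eq] at hα ⊢
    exact (Cardinal.isSuccLimit_omega 1).succ_lt (Ordinal.iSup_lt_omega_one hα)
  rw [Bfam_of_ne_zero (Order.succ_ne_bot _)]
  set U : Set (Set (Set ℕ)) := {I | ∃ ξ, ∃ _ : ξ < Order.succ (⨆ n, α n), I ∈ Bfam ξ}
  have huniv : Set.univ ∈ U := ⟨0, Order.bot_lt_succ _, by simp [Bfam_zero]⟩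
  have hJU : ∀ n, J n ∈ U := fun n =>
    ⟨α n, Order.lt_succ_of_le (Ordinal.le_iSup α n), hJ n⟩
  refine ⟨1, fun i => if i = 0 then finIdeal else orth (directSumN J), fun i _ => ?_,
    sum2_eq_finSumN _ _⟩
  dsimp only
  split_ifs
  exacts [finIdeal_mem_sumsPerpOf huniv, Or.inr ⟨_, ⟨J, hJU, rfl⟩, rfl⟩]

end Hierarchy

section WellFoundedSets

theorem genTree_mono {A B : Set (List ℕ)} (h : A ⊆ B) : genTree A ⊆ genTree B :=
  fun _ ⟨a, ha, hta⟩ => ⟨a, h ha, hta⟩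

theorem isTree_genTree (A : Set (List ℕ)) : IsTree (genTree A) :=
  fun _ ⟨a, ha, hsa⟩ _ hts => ⟨a, ha, hts.trans hsa⟩

theorem Iwf_of_genTree_subset {A B : Set (List ℕ)} (hB : B ∈ Iwf)
    (h : genTree A ⊆ genTree B) : A ∈ Iwf :=
  fun ⟨α, hα⟩ => hB ⟨α, fun n => h (hα n)⟩

theorem Iwf_of_subset {A B : Set (List ℕ)} (hB : B ∈ Iwf) (h : A ⊆ B) : A ∈ Iwf :=
  Iwf_of_genTree_subset hB (genTree_mono h)

theorem ofFn_prefix_ofFn (α : ℕ → ℕ) {m n : ℕ} (h : m ≤ n) :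
    (List.ofFn fun i : Fin m => α i) <+: List.ofFn fun i : Fin n => α i := by
  induction n, h using Nat.le_induction with
  | base => exact List.prefix_rfl
  | succ n _ ih =>
    rw [List.ofFn_succ_last]
    exact ih.trans (List.prefix_append _ _)

theorem finite_mem_Iwf {A : Set (List ℕ)} (hA : A.Finite) : A ∈ Iwf := by
  rintro ⟨α, hα⟩
  obtain ⟨N, hN⟩ := (hA.image List.length).bddAbove
  obtain ⟨a, ha, hpre⟩ := hα (N + 1)
  have h1 := hpre.length_le
  have h2 := hN (mem_image_of_mem _ ha)
  rw [List.length_ofFn] at h1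
  omega

theorem union_mem_Iwf {A B : Set (List ℕ)} (hA : A ∈ Iwf) (hB : B ∈ Iwf) : A ∪ B ∈ Iwf := by
  rintro ⟨α, hα⟩
  have key : ∀ {C : Set (List ℕ)}, C ∈ Iwf →
      ∃ N, ∀ n ≥ N, (List.ofFn fun i : Fin n => α i) ∉ genTree C := by
    intro C hC
    by_contra! h
    refine hC ⟨α, fun m => ?_⟩
    obtain ⟨n, hn, hmem⟩ := h m
    exact isTree_genTree C _ hmem _ (ofFn_prefix_ofFn α hn)
  obtain ⟨N, hN⟩ := key hA
  obtain ⟨M, hM⟩ := key hB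
  obtain ⟨c, hc | hc, hpre⟩ := hα (max N M)
  · exact hN _ (le_max_left N M) ⟨c, hc, hpre⟩
  · exact hM _ (le_max_right N M) ⟨c, hc, hpre⟩

theorem biUnion_mem_Iwf {ι : Type*} {S : Set ι} (hS : S.Finite) {A : ι → Set (List ℕ)}
    (hA : ∀ i ∈ S, A i ∈ Iwf) : ⋃ i ∈ S, A i ∈ Iwf := by
  induction S, hS using Set.Finite.induction_on with
  | empty => simpa using finite_mem_Iwf finite_empty
  | insert _ _ ih =>
    rw [biUnion_insert]
    exact union_mem_Iwf (hA _ (mem_insert _ _)) (ih fun i hi => hA i (mem_insert_of_mem _ hi))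

/-- **Kőnig's lemma**: a dominated set which is well founded is finite. -/
theorem finite_of_mem_Iwf_of_mem_Idom {A : Set (List ℕ)} (hwf : A ∈ Iwf) (hd : A ∈ Idom) :
    A.Finite := by
  by_contra hinf
  obtain ⟨α, hα⟩ := hd
  have hstep : ∀ t, (subAt A t).Infinite → ∃ k, (subAt A (t ++ [k])).Infinite := by
    intro t ht
    by_contra! h
    refine ht (((finite_singleton t).union
      ((finite_Iic (α t.length)).biUnion fun k _ => h k)).subset ?_)
    rintro s ⟨hsA, r, rfl⟩
    rcases r with _ | ⟨k, r⟩
    · simp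
    · refine Or.inr (mem_biUnion (x := k) ?_ ⟨hsA, r, by simp⟩)
      simpa using hα _ hsA ⟨t.length, by simp⟩
  choose! next hnext using hstep
  let seq : ℕ → List ℕ := fun n => Nat.rec [] (fun _ t => t ++ [next t]) n
  have hseq : ∀ n, (subAt A (seq n)).Infinite := by
    intro n
    induction n with
    | zero =>
      have : subAt A (seq 0) = A := by
        ext s
        simp [subAt, seq]
      rwa [this]
    | succ n ih => exact hnext _ ih
  refine hwf ⟨fun n => next (seq n), fun n => ?_⟩
  have heq : (List.ofFn fun i : Fin n => next (seq i)) = seq n := by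
    induction n with
    | zero => rfl
    | succ n ih =>
      rw [List.ofFn_succ_last]
      simp only [Fin.val_castSucc, Fin.val_last, ih]
      rfl
  obtain ⟨s, hsA, hs⟩ := (hseq n).nonempty
  exact ⟨s, hsA, heq ▸ hs⟩

theorem Idom_of_subset {A B : Set (List ℕ)} (hB : B ∈ Idom) (h : A ⊆ B) : A ∈ Idom :=
  let ⟨α, hα⟩ := hB
  ⟨α, fun s hs => hα s (h hs)⟩

/-- Description of the well founded subsets of a dominated set `H` with sets `P s` of
extensions attached to the points `s ∈ H`. -/
theorem mem_Iwf_iff_of_subset {H : Set (List ℕ)} (hHd : H ∈ Idom) {P : List ℕ → Set (List ℕ)}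
    (hext : ∀ s ∈ H, ∀ p ∈ P s, s <+: p) {A : Set (List ℕ)} (hA : A ⊆ H ∪ ⋃ s ∈ H, P s) :
    A ∈ Iwf ↔ (A ∩ H).Finite ∧ (∀ s ∈ H, A ∩ P s ∈ Iwf) ∧
      {s ∈ H | (A ∩ P s).Nonempty}.Finite := by
  constructor
  · intro h
    refine ⟨?_, fun s _ => Iwf_of_subset h inter_subset_left, ?_⟩
    · exact finite_of_mem_Iwf_of_mem_Idom (Iwf_of_subset h inter_subset_left)
        (Idom_of_subset hHd inter_subset_right)
    · refine finite_of_mem_Iwf_of_mem_Idom (Iwf_of_genTree_subset h ?_)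
        (Idom_of_subset hHd fun s hs => hs.1)
      rintro t ⟨s, ⟨hsH, p, hpA, hpP⟩, hts⟩
      exact ⟨p, hpA, hts.trans (hext s hsH p hpP)⟩
  · rintro ⟨hfin, hwf, hsupp⟩
    refine Iwf_of_subset (union_mem_Iwf (finite_mem_Iwf hfin)
      (biUnion_mem_Iwf hsupp fun s hs => hwf s hs.1)) fun a ha => ?_
    rcases hA ha with haH | haP
    · exact Or.inl ⟨ha, haH⟩
    · obtain ⟨s, hs, has⟩ := mem_iUnion₂.1 haP
      exact Or.inr (mem_biUnion (x := s) ⟨hs, a, ha, has⟩ ⟨ha, has⟩)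

end WellFoundedSets

/-- Membership of a restriction in `ℬ`, in terms of an enumeration of the set. -/
theorem inB_restrictIdeal_iff {X : Type*} {I : Set (Set X)} {K : Set X} :
    InB (restrictIdeal I K) ↔ ∃ α < omega1, ∃ J ∈ Bfam α, ∃ F : ℕ → X,
      Function.Injective F ∧ range F = K ∧ ∀ A : Set ℕ, F '' A ∈ I ↔ A ∈ J := by
  constructor
  · rintro ⟨α, hα, J, hJ, f, hf⟩
    refine ⟨α, hα, J, hJ, fun n => (f.symm n : X),
      Subtype.val_injective.comp f.symm.injective, ?_, fun A => ?_⟩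
    · have h := f.symm.surjective.range_comp (Subtype.val : K → X)
      rw [Subtype.range_coe] at h
      exact h
    · have h := hf (f.symm '' A)
      rw [Equiv.image_symm_image f A] at h
      rw [← h]
      simp only [restrictIdeal, mem_ofPred_eq, image_image]
  · rintro ⟨α, hα, J, hJ, F, hinj, rfl, hF⟩
    refine ⟨α, hα, J, hJ, (Equiv.ofInjective F hinj).symm, fun A => ?_⟩
    rw [← hF, image_image]
    have h : (fun x => F ((Equiv.ofInjective F hinj).symm x)) = Subtype.val :=
      funext fun x => Equiv.apply_ofInjective_symm hinj x
    rw [h]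
    rfl

/-- Lemma 5.5: let `H` be an infinite tree in `I_d`, and for `s ∈ H` let
`P_s` be pairwise disjoint sets of proper extensions of `s` with `P_s ∩ H = ∅`.
If `I_wf ↾ P_s ∈ ℬ` for all `s ∈ H`, then `I_wf ↾ (H ∪ ⋃_{s∈H} P_s) ∈ ℬ`. -/
theorem stmt13 (H : Set (List ℕ)) (hHtree : IsTree H) (hHinf : H.Infinite)
    (hHd : H ∈ Idom) (P : List ℕ → Set (List ℕ))
    (hext : ∀ s ∈ H, ∀ p ∈ P s, s <+: p ∧ s ≠ p)
    (hdisjH : ∀ s ∈ H, Disjoint (P s) H)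
    (hpair : ∀ s ∈ H, ∀ t ∈ H, s ≠ t → Disjoint (P s) (P t))
    (hB : ∀ s ∈ H, InB (restrictIdeal Iwf (P s))) :
    InB (restrictIdeal Iwf (H ∪ ⋃ s ∈ H, P s)) := by
  obtain ⟨e⟩ : Nonempty (ℕ ≃ H) :=
    haveI := hHinf.to_subtype
    nonempty_equiv_of_countable
  choose! α hα J hJ G hGinj hGrange hG using fun s hs => inB_restrictIdeal_iff.1 (hB s hs)
  have heH : ∀ n, (e n : List ℕ) ∈ H := fun n => (e n).2
  choose β hβ hJβ using fun n => exists_orth_mem_Bfam (hα _ (heH n)) (hJ _ (heH n))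
  obtain ⟨γ, hγ, hmem⟩ := exists_sum2_finIdeal_orth_mem_Bfam hβ hJβ
  have hGP : ∀ n m, G (e n) m ∈ P (e n) := fun n m => hGrange _ (heH n) ▸ mem_range_self m
  obtain ⟨F, hF0, hF1⟩ : ∃ F : ℕ → List ℕ, (∀ m, F (2 * m) = e m) ∧
      ∀ n m, F (2 * Nat.pair n m + 1) = G (e n) m := by
    refine ⟨fun x => if x % 2 = 0 then e (x / 2)
      else G (e (x / 2).unpair.1) (x / 2).unpair.2, fun m => ?_, fun n m => ?_⟩
    · simp
    · have h1 : (2 * Nat.pair n m + 1) % 2 = 1 := by omega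
      have h2 : (2 * Nat.pair n m + 1) / 2 = Nat.pair n m := by omega
      simp [h1, h2]
  have hcases : ∀ x : ℕ, (∃ m, x = 2 * m) ∨ ∃ n m, x = 2 * Nat.pair n m + 1 := by
    intro x
    rcases Nat.even_or_odd' x with ⟨k, rfl | rfl⟩
    · exact Or.inl ⟨k, rfl⟩
    · exact Or.inr ⟨k.unpair.1, k.unpair.2, by rw [Nat.pair_unpair]⟩
  have hFP : ∀ x n, F x ∈ P (e n) ↔ ∃ m, x = 2 * Nat.pair n m + 1 := by
    intro x n
    constructor
    · intro hx
      rcases hcases x with ⟨m, rfl⟩ | ⟨k, m, rfl⟩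
      · rw [hF0] at hx
        exact (disjoint_left.1 (hdisjH _ (heH n)) hx (heH m)).elim
      · rw [hF1] at hx
        by_cases hkn : k = n
        · exact ⟨m, by rw [hkn]⟩
        · have hne : (e k : List ℕ) ≠ e n := fun h => hkn (e.injective (Subtype.ext h))
          exact (disjoint_left.1 (hpair _ (heH k) _ (heH n) hne) (hGP k m) hx).elim
    · rintro ⟨m, rfl⟩
      rw [hF1]
      exact hGP n m
  have hFH : ∀ x, F x ∈ H ↔ ∃ m, x = 2 * m := by
    intro x
    constructor
    · intro hx
      rcases hcases x with h | ⟨k, m, rfl⟩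
      · exact h
      · rw [hF1] at hx
        exact (disjoint_left.1 (hdisjH _ (heH k)) (hGP k m) hx).elim
    · rintro ⟨m, rfl⟩
      rw [hF0]
      exact heH m
  have hFinj : Function.Injective F := by
    intro x y hxy
    rcases hcases x with ⟨m, rfl⟩ | ⟨n, m, rfl⟩
    · obtain ⟨k, rfl⟩ := (hFH y).1 (hxy ▸ (hFH _).2 ⟨m, rfl⟩)
      rw [hF0, hF0] at hxy
      rw [e.injective (Subtype.ext hxy)]
    · obtain ⟨k, rfl⟩ := (hFP y n).1 (hxy ▸ (hFP _ n).2 ⟨m, rfl⟩)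
      rw [hF1, hF1] at hxy
      rw [hGinj _ (heH n) hxy]
  have hFrange : range F = H ∪ ⋃ s ∈ H, P s := by
    refine Subset.antisymm ?_ ?_
    · rintro _ ⟨x, rfl⟩
      rcases hcases x with h | ⟨n, h⟩
      · exact Or.inl ((hFH x).2 h)
      · exact Or.inr (mem_biUnion (heH n) ((hFP x n).2 h))
    · rintro t (ht | ht)
      · exact ⟨2 * e.symm ⟨t, ht⟩, by rw [hF0, e.apply_symm_apply]⟩
      · obtain ⟨s, hs, hts⟩ := mem_iUnion₂.1 ht
        obtain ⟨n, hn⟩ := e.surjective ⟨s, hs⟩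
        have hns : (e n : List ℕ) = s := congrArg Subtype.val hn
        rw [← hGrange s hs] at hts
        obtain ⟨m, rfl⟩ := hts
        exact ⟨2 * Nat.pair n m + 1, by rw [hF1, hns]⟩
  refine inB_restrictIdeal_iff.2 ⟨γ, hγ, _, hmem, F, hFinj, hFrange, fun A => ?_⟩
  have hFr : ∀ n, IsFrechet (J (e n)) := fun n => isFrechet_of_mem_Bfam (hJ _ (heH n))
  have hAH : F '' A ∩ H = (fun m => (e m : List ℕ)) '' {m | 2 * m ∈ A} := by
    ext t
    constructor
    · rintro ⟨⟨x, hx, rfl⟩, hxH⟩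
      obtain ⟨m, rfl⟩ := (hFH x).1 hxH
      exact ⟨m, hx, (hF0 m).symm⟩
    · rintro ⟨m, hm, rfl⟩
      exact ⟨⟨_, hm, hF0 m⟩, heH m⟩
  have hAP : ∀ n, F '' A ∩ P (e n) = G (e n) '' {m | 2 * Nat.pair n m + 1 ∈ A} := by
    intro n
    ext t
    constructor
    · rintro ⟨⟨x, hx, rfl⟩, hxP⟩
      obtain ⟨m, rfl⟩ := (hFP x n).1 hxP
      exact ⟨m, hx, (hF1 n m).symm⟩
    · rintro ⟨m, hm, rfl⟩
      exact ⟨⟨_, hm, hF1 n m⟩, hGP n m⟩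
  have heinj : Function.Injective fun m => (e m : List ℕ) :=
    Subtype.val_injective.comp e.injective
  have hsupp : {s ∈ H | (F '' A ∩ P s).Nonempty} =
      (fun n => (e n : List ℕ)) '' {n | {m | 2 * Nat.pair n m + 1 ∈ A}.Nonempty} := by
    ext s
    constructor
    · rintro ⟨hs, hne⟩
      obtain ⟨n, hn⟩ := e.surjective ⟨s, hs⟩
      obtain rfl : (e n : List ℕ) = s := congrArg Subtype.val hn
      rw [hAP, image_nonempty] at hne
      exact ⟨n, hne, rfl⟩
    · rintro ⟨n, hn, rfl⟩
      exact ⟨heH n, by rw [hAP, image_nonempty]; exact hn⟩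
  have hsections : (∀ s ∈ H, F '' A ∩ P s ∈ Iwf) ↔
      ∀ n, {m | 2 * Nat.pair n m + 1 ∈ A} ∈ J (e n) := by
    constructor
    · intro h n
      rw [← hG _ (heH n), ← hAP]
      exact h _ (heH n)
    · intro h s hs
      obtain ⟨n, hn⟩ := e.surjective ⟨s, hs⟩
      obtain rfl : (e n : List ℕ) = s := congrArg Subtype.val hn
      rw [hAP, hG _ (heH n)]
      exact h n
  rw [mem_Iwf_iff_of_subset hHd (fun s hs p hp => (hext s hs p hp).1)
      (hFrange ▸ image_subset_range F A), hAH, hsupp, hsections,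
    finite_image_iff heinj.injOn, finite_image_iff heinj.injOn]
  refine and_congr Iff.rfl ?_
  rw [mem_orth_directSumN (fun n => empty_mem_orth _)
    fun n m => (isFrechet_orth _).finite_mem (finite_singleton m)]
  refine and_congr (forall_congr' fun n => ?_) Iff.rfl
  rw [show orth (orth (J (e n))) = J (e n) from hFr n]
  rfl
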